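/- Let N = ℝ⟨OT⟩ be the vector space spanned by forests of planar rooted trees colored by a set C, with concatenation product, left grafting [·], and unit the empty forest 1. Then N is the free D-algebra over C: for any D-algebra A and any map ν : C → D(A), there exists a unique map F_ν : N → A which is a D-algebra homomorphism (F_ν(1) = 1, F_ν(gh) = F_ν(g)F_ν(h), F_ν(g[h]) = F_ν(g)[F_ν(h)], and F_ν maps D(N) into D(A)) and satisfies F_ν(c) = ν(c) for all c ∈ C. -/

import Mathlib

noncomputable section

mutual
/-- A planar (ordered) rooted tree with nodes colored by `C`. -/
inductive PTree (C : Type) : Type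
  | node : C → PForest C → PTree C
/-- A planar forest: an ordered list of planar rooted trees. -/
inductive PForest (C : Type) : Type
  | nil : PForest C
  | cons : PTree C → PForest C → PForest C
end

/-- Concatenation of forests. -/
def PForest.app {C : Type} : PForest C → PForest C → PForest C
  | .nil, w => w
  | .cons t u, w => .cons t (PForest.app u w)

/-- The free `ℝ`-vector space `N = ℝ⟨OT⟩` on planar forests. -/
abbrev NA (C : Type) : Type := PForest C →₀ ℝ

/-- The concatenation product on `N`, as a bilinear map. -/
def concL {C : Type} : NA C →ₗ[ℝ] NA C →ₗ[ℝ] NA C :=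
  Finsupp.lsum ℝ fun w =>
    LinearMap.toSpanSingleton ℝ (NA C →ₗ[ℝ] NA C)
      (Finsupp.lsum ℝ fun w' =>
        LinearMap.toSpanSingleton ℝ (NA C) (Finsupp.single (w.app w') 1))

/-- `B⁺_c` on a single forest: attach the branches to a new root colored `c`. -/
def bplusF {C : Type} (c : C) (ω : PForest C) : PForest C :=
  PForest.cons (PTree.node c ω) PForest.nil

/-- The data of a D-algebra: a product, a unit, and a (non-associative)
composition `f, g ↦ f[g]`. -/
structure DAlgData (A : Type) [AddCommGroup A] [Module ℝ A] where
  mul : A →ₗ[ℝ] A →ₗ[ℝ] A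
  one : A
  br : A →ₗ[ℝ] A →ₗ[ℝ] A

/-- The set `D(A)` of derivation elements of a D-algebra. -/
def DAlgData.Der {A : Type} [AddCommGroup A] [Module ℝ A] (𝔄 : DAlgData A) : Set A :=
  {f | ∀ g h : A, 𝔄.br f (𝔄.mul g h) = 𝔄.mul (𝔄.br f g) h + 𝔄.mul g (𝔄.br f h)}

/-- The axioms of a D-algebra. -/
structure DAlgData.IsDAlgebra {A : Type} [AddCommGroup A] [Module ℝ A]
    (𝔄 : DAlgData A) : Prop where
  mul_assoc : ∀ a b c : A, 𝔄.mul (𝔄.mul a b) c = 𝔄.mul a (𝔄.mul b c)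
  one_mul : ∀ a : A, 𝔄.mul 𝔄.one a = a
  mul_one : ∀ a : A, 𝔄.mul a 𝔄.one = a
  -- `D(A)` generates `A` as a unital algebra
  der_generates : ∀ p : Submodule ℝ A, 𝔄.one ∈ p → (∀ f ∈ 𝔄.Der, f ∈ p) →
    (∀ a ∈ p, ∀ b ∈ p, 𝔄.mul a b ∈ p) → p = ⊤
  br_mem_der : ∀ f ∈ 𝔄.Der, ∀ g : A, 𝔄.br g f ∈ 𝔄.Der
  one_br : ∀ g : A, 𝔄.br 𝔄.one g = g
  br_comp : ∀ f ∈ 𝔄.Der, ∀ g h : A,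
    𝔄.br f (𝔄.br g h) = 𝔄.br (𝔄.mul f g) h + 𝔄.br (𝔄.br f g) h

/-- A D-algebra homomorphism. -/
def IsDAlgHom {A B : Type} [AddCommGroup A] [Module ℝ A] [AddCommGroup B] [Module ℝ B]
    (𝔄 : DAlgData A) (𝔅 : DAlgData B) (F : A →ₗ[ℝ] B) : Prop :=
  F 𝔄.one = 𝔅.one ∧
  (∀ a b : A, F (𝔄.mul a b) = 𝔅.mul (F a) (F b)) ∧
  (∀ a b : A, F (𝔄.br a b) = 𝔅.br (F a) (F b)) ∧
  (∀ f ∈ 𝔄.Der, F f ∈ 𝔅.Der)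

/-- The basis element of `N` given by a forest. -/
abbrev NA.of {C : Type} (w : PForest C) : NA C := Finsupp.single w 1

/-- The basis element of `N` given by a tree, seen as a one-tree forest. -/
abbrev NA.ofTree {C : Type} (t : PTree C) : NA C := NA.of (PForest.cons t PForest.nil)

namespace PForest

variable {C : Type}

mutual
theorem tree_aux {P : PForest C → Prop} (nil : P nil)
    (cons : ∀ c u v, P u → P v → P (cons (PTree.node c u) v)) :
    (t : PTree C) → ∀ v, P v → P (PForest.cons t v)
  | .node c u => fun v hv => cons c u v (forest_aux nil cons u) hv
theorem forest_aux {P : PForest C → Prop} (nil : P nil)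
    (cons : ∀ c u v, P u → P v → P (PForest.cons (PTree.node c u) v)) :
    (w : PForest C) → P w
  | .nil => nil
  | .cons t v => tree_aux nil cons t v (forest_aux nil cons v)
end

/-- Induction on planar forests, through the branches of the first tree and the other trees. -/
theorem forest_induction {P : PForest C → Prop} (nil : P nil)
    (cons : ∀ c u v, P u → P v → P (PForest.cons (PTree.node c u) v)) (w : PForest C) : P w :=
  forest_aux nil cons w

/-- The number of trees of a forest. -/
def length : PForest C → ℕ
  | .nil => 0
  | .cons _ u => length u + 1

theorem app_nil (w : PForest C) : w.app nil = w := by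
  induction w using forest_induction with
  | nil => rfl
  | cons c u v _ hv => rw [app, hv]

theorem length_app (u v : PForest C) : (u.app v).length = u.length + v.length := by
  induction u using forest_induction with
  | nil => simp [app, length]
  | cons c u w _ hw => rw [app, length, length, hw]; omega

end PForest

namespace NA

variable {C : Type}

theorem concL_of (u v : PForest C) : concL (of u) (of v) = of (u.app v) := by
  simp [concL]

/-- Two linear maps on `N` that agree on forests are equal. -/
theorem hom_ext {M : Type} [AddCommGroup M] [Module ℝ M] {F G : NA C →ₗ[ℝ] M}
    (h : ∀ w, F (of w) = G (of w)) : F = G :=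
  Finsupp.lhom_ext' fun w => LinearMap.ext_ring (h w)

theorem one_concL (x : NA C) : concL (of PForest.nil) x = x := by
  have : concL (of PForest.nil) = (LinearMap.id : NA C →ₗ[ℝ] NA C) :=
    hom_ext fun w => by simp [concL_of, PForest.app]
  simp [this]

theorem concL_one (x : NA C) : concL x (of PForest.nil) = x := by
  have : concL.flip (of PForest.nil) = (LinearMap.id : NA C →ₗ[ℝ] NA C) :=
    hom_ext fun w => by simp [concL_of, PForest.app_nil]
  exact congrArg (fun f => f x) this

/-- The span of the forests with `n` trees. -/
def homogeneous (C : Type) (n : ℕ) : Submodule ℝ (NA C) :=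
  Submodule.span ℝ {x | ∃ w : PForest C, w.length = n ∧ x = of w}

theorem of_mem_homogeneous (w : PForest C) : of w ∈ homogeneous C w.length :=
  Submodule.subset_span ⟨w, rfl, rfl⟩

theorem ofTree_mem_homogeneous (t : PTree C) : ofTree t ∈ homogeneous C 1 :=
  Submodule.subset_span ⟨PForest.cons t PForest.nil, by simp [PForest.length], rfl⟩

theorem concL_mem_homogeneous {m n : ℕ} {x y : NA C} (hx : x ∈ homogeneous C m)
    (hy : y ∈ homogeneous C n) : concL x y ∈ homogeneous C (m + n) := by
  have := Submodule.apply_mem_map₂ concL hx hy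
  refine (Submodule.map₂_le.2 ?_ : _ ≤ homogeneous C (m + n)) this
  intro a ha b hb
  induction ha using Submodule.span_induction with
  | zero => simp
  | add a a' _ _ h h' => simpa using add_mem h h'
  | smul r a _ h => simpa using Submodule.smul_mem _ r h
  | mem a ha =>
    obtain ⟨u, rfl, rfl⟩ := ha
    induction hb using Submodule.span_induction with
    | zero => simp
    | add a a' _ _ h h' => simpa using add_mem h h'
    | smul r a _ h => simpa using Submodule.smul_mem _ r h
    | mem b hb =>
      obtain ⟨v, rfl, rfl⟩ := hb
      rw [concL_of, ← PForest.length_app]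
      exact of_mem_homogeneous _

end NA

open NA

/-- The defining equations of left grafting. -/
structure IsGrafting {C : Type} (gr : NA C →ₗ[ℝ] NA C →ₗ[ℝ] NA C) : Prop where
  leaf : ∀ (ω : PForest C) (c : C), gr (of ω) (ofTree (PTree.node c PForest.nil)) =
    ofTree (PTree.node c ω)
  one : ∀ ω : PForest C, gr (of PForest.nil) (of ω) = of ω
  leibniz : ∀ (τ : PTree C) (ω ω' : PForest C), gr (ofTree τ) (of (ω.app ω')) =
    concL (gr (ofTree τ) (of ω)) (of ω') + concL (of ω) (gr (ofTree τ) (of ω'))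
  comp : ∀ (τ : PTree C) (ω ω' : PForest C), gr (of (PForest.cons τ ω)) (of ω') =
    gr (ofTree τ) (gr (of ω) (of ω')) - gr (gr (ofTree τ) (of ω)) (of ω')

namespace IsGrafting

variable {C : Type} {gr : NA C →ₗ[ℝ] NA C →ₗ[ℝ] NA C}

theorem one_gr (hg : IsGrafting gr) (x : NA C) : gr (of PForest.nil) x = x := by
  have : gr (of PForest.nil) = LinearMap.id := hom_ext fun w => by simp [hg.one]
  simp [this]

theorem gr_concL (hg : IsGrafting gr) (τ : PTree C) (x y : NA C) :
    gr (ofTree τ) (concL x y) = concL (gr (ofTree τ) x) y + concL x (gr (ofTree τ) y) := by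
  have : concL.compr₂ (gr (ofTree τ)) =
      concL ∘ₗ gr (ofTree τ) + concL.compl₂ (gr (ofTree τ)) := by
    refine hom_ext fun u => hom_ext fun v => ?_
    simpa [concL_of] using hg.leibniz τ u v
  exact congrArg (fun f => f x y) this

theorem gr_one (hg : IsGrafting gr) (τ : PTree C) : gr (ofTree τ) (of PForest.nil) = 0 := by
  have h := hg.leibniz τ PForest.nil PForest.nil
  rw [one_concL, concL_one, PForest.app] at h
  exact left_eq_add.1 h

theorem gr_gr (hg : IsGrafting gr) (τ : PTree C) (ω : PForest C) (x : NA C) :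
    gr (ofTree τ) (gr (of ω) x) = gr (of (PForest.cons τ ω)) x + gr (gr (ofTree τ) (of ω)) x := by
  have : gr (ofTree τ) ∘ₗ gr (of ω) =
      gr (of (PForest.cons τ ω)) + gr (gr (ofTree τ) (of ω)) := by
    refine hom_ext fun u => ?_
    simp only [LinearMap.comp_apply, LinearMap.add_apply]
    rw [hg.comp τ ω u, sub_add_cancel]
  exact congrArg (fun f => f x) this

/-- Grafting a tree on a tree with branches `u` and root `c`. -/
theorem gr_node (hg : IsGrafting gr) (τ : PTree C) (c : C) (u : PForest C) :
    gr (ofTree τ) (ofTree (PTree.node c u)) = ofTree (PTree.node c (PForest.cons τ u)) +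
      gr (gr (ofTree τ) (of u)) (ofTree (PTree.node c PForest.nil)) := by
  rw [← hg.leaf u c, hg.gr_gr, hg.leaf]

theorem gr_cons (hg : IsGrafting gr) (τ σ : PTree C) (u : PForest C) :
    gr (ofTree τ) (of (PForest.cons σ u)) =
      concL (gr (ofTree τ) (ofTree σ)) (of u) + concL (ofTree σ) (gr (ofTree τ) (of u)) :=
  hg.leibniz τ (PForest.cons σ PForest.nil) u

theorem gr_leaf_mem_homogeneous (hg : IsGrafting gr) (x : NA C) (c : C) :
    gr x (ofTree (PTree.node c PForest.nil)) ∈ homogeneous C 1 := by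
  induction x using Finsupp.induction_linear with
  | zero => simp
  | add x y hx hy => simpa using add_mem hx hy
  | single w r =>
    rw [← mul_one r, ← smul_eq_mul, ← Finsupp.smul_single, map_smul, LinearMap.smul_apply, hg.leaf]
    exact Submodule.smul_mem _ _ (ofTree_mem_homogeneous _)

theorem gr_mem_homogeneous (hg : IsGrafting gr) (τ : PTree C) (ω : PForest C) :
    gr (ofTree τ) (of ω) ∈ homogeneous C ω.length := by
  induction ω using PForest.forest_induction with
  | nil => simp [hg.gr_one]
  | cons c u v _ hv =>
    rw [hg.gr_cons, PForest.length, add_comm]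
    refine add_mem (concL_mem_homogeneous ?_ (of_mem_homogeneous v))
      (concL_mem_homogeneous (ofTree_mem_homogeneous _) hv)
    rw [hg.gr_node]
    exact add_mem (ofTree_mem_homogeneous _) (hg.gr_leaf_mem_homogeneous _ _)

/-- Induction along the recursion `(τω)[·] = τ[ω[·]] - (τ[ω])[·]`. -/
theorem eq_top_of_cons (hg : IsGrafting gr) (p : Submodule ℝ (NA C)) (nil : of PForest.nil ∈ p)
    (cons : ∀ τ ω, of ω ∈ p → gr (ofTree τ) (of ω) ∈ p → of (PForest.cons τ ω) ∈ p) :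
    p = ⊤ := by
  have key : ∀ n, ∀ w : PForest C, w.length = n → of w ∈ p := by
    intro n
    induction n with
    | zero =>
      rintro (_ | ⟨t, u⟩) h
      · exact nil
      · simp [PForest.length] at h
    | succ n ih =>
      rintro (_ | ⟨t, u⟩) h
      · simp [PForest.length] at h
      · have hu : u.length = n := by simpa [PForest.length] using h
        have hle : homogeneous C n ≤ p := by
          refine Submodule.span_le.2 ?_
          rintro _ ⟨w, hw, rfl⟩
          exact ih w hw
        exact cons t u (ih u hu) (hle (hu ▸ hg.gr_mem_homogeneous t u))
  refine eq_top_iff.2 fun x _ => ?_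
  induction x using Finsupp.induction_linear with
  | zero => simp
  | add x y hx hy => exact add_mem (hx trivial) (hy trivial)
  | single w r =>
    rw [← mul_one r, ← smul_eq_mul, ← Finsupp.smul_single]
    exact Submodule.smul_mem _ _ (key _ w rfl)

theorem gr_ofTree_gr (hg : IsGrafting gr) (τ : PTree C) (x z : NA C) :
    gr (ofTree τ) (gr x z) = gr (concL (ofTree τ) x + gr (ofTree τ) x) z := by
  have : gr.compr₂ (gr (ofTree τ)) = gr ∘ₗ (concL (ofTree τ) + gr (ofTree τ)) := by
    refine hom_ext (M := NA C →ₗ[ℝ] NA C) fun u => LinearMap.ext fun z => ?_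
    simp only [LinearMap.compr₂_apply, LinearMap.comp_apply, LinearMap.add_apply, map_add,
      concL_of, PForest.app]
    exact hg.gr_gr τ u z
  exact congrArg (fun f => f x z) this

/-- The span of the products `x[c]y[c]`. -/
def twoRooted (gr : NA C →ₗ[ℝ] NA C →ₗ[ℝ] NA C) (c : C) : Submodule ℝ (NA C) :=
  Submodule.span ℝ {z | ∃ x y : NA C, z = concL (gr x (ofTree (PTree.node c PForest.nil)))
    (gr y (ofTree (PTree.node c PForest.nil)))}

theorem gr_mem_twoRooted (hg : IsGrafting gr) (c : C) (τ : PTree C) {z : NA C}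
    (hz : z ∈ twoRooted gr c) : gr (ofTree τ) z ∈ twoRooted gr c := by
  induction hz using Submodule.span_induction with
  | zero => simp
  | add a b _ _ ha hb => rw [map_add]; exact add_mem ha hb
  | smul r a _ ha => rw [map_smul]; exact Submodule.smul_mem _ r ha
  | mem z hz =>
    obtain ⟨x, y, rfl⟩ := hz
    rw [hg.gr_concL, hg.gr_ofTree_gr, hg.gr_ofTree_gr]
    exact add_mem (Submodule.subset_span ⟨_, _, rfl⟩) (Submodule.subset_span ⟨_, _, rfl⟩)

theorem eq_zero_of_mem_der [IsEmpty C] (hg : IsGrafting gr) {x : NA C}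
    (hx : x ∈ DAlgData.Der ⟨concL, of PForest.nil, gr⟩) : x = 0 := by
  have hone : gr.flip (of PForest.nil) = LinearMap.id := by
    refine hom_ext fun w => ?_
    rcases w with _ | ⟨⟨c, _⟩, _⟩
    · exact hg.one_gr _
    · exact isEmptyElim c
  have h : gr x (concL (of PForest.nil) (of PForest.nil)) = _ := hx (of PForest.nil) _
  simp only [one_concL, concL_one] at h
  have hx1 : gr x (of PForest.nil) = x := congrArg (fun f => f x) hone
  rw [hx1] at h
  exact left_eq_add.1 h

end IsGrafting

namespace DAlgData

variable {C A : Type} [AddCommGroup A] [Module ℝ A]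

mutual
/-- The value on a tree of the universal map induced by `ν`. -/
def evalTree (𝔄 : DAlgData A) (ν : C → A) : PTree C → A
  | .node c u => 𝔄.br (evalForest 𝔄 ν u) (ν c)
/-- The value on a forest of the universal map induced by `ν`. -/
def evalForest (𝔄 : DAlgData A) (ν : C → A) : PForest C → A
  | .nil => 𝔄.one
  | .cons t u => 𝔄.mul (evalTree 𝔄 ν t) (evalForest 𝔄 ν u)
end

/-- The universal map `N → A` induced by `ν`. -/
def lift (𝔄 : DAlgData A) (ν : C → A) : NA C →ₗ[ℝ] A :=
  Finsupp.linearCombination ℝ (evalForest 𝔄 ν)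

variable {𝔄 : DAlgData A} {ν : C → A}

theorem lift_of (w : PForest C) : 𝔄.lift ν (of w) = 𝔄.evalForest ν w := by
  simp [lift]

theorem lift_one : 𝔄.lift ν (of PForest.nil) = 𝔄.one := by
  rw [lift_of, evalForest]

theorem lift_ofTree (h𝔄 : 𝔄.IsDAlgebra) (t : PTree C) :
    𝔄.lift ν (ofTree t) = 𝔄.evalTree ν t := by
  rw [lift_of, evalForest, evalForest, h𝔄.mul_one]

theorem lift_leaf (h𝔄 : 𝔄.IsDAlgebra) (c : C) :
    𝔄.lift ν (ofTree (PTree.node c PForest.nil)) = ν c := by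
  rw [lift_ofTree h𝔄, evalTree, evalForest, h𝔄.one_br]

theorem lift_mul (h𝔄 : 𝔄.IsDAlgebra) (x y : NA C) :
    𝔄.lift ν (concL x y) = 𝔄.mul (𝔄.lift ν x) (𝔄.lift ν y) := by
  have : concL.compr₂ (𝔄.lift ν) = 𝔄.mul.compl₁₂ (𝔄.lift ν) (𝔄.lift ν) := by
    refine hom_ext fun u => hom_ext fun v => ?_
    simp only [LinearMap.compr₂_apply, LinearMap.compl₁₂_apply, concL_of, lift_of]
    induction u using PForest.forest_induction with
    | nil => rw [PForest.app, evalForest, h𝔄.one_mul]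
    | cons c u w _ hw => rw [PForest.app, evalForest, evalForest, hw, h𝔄.mul_assoc]
  exact congrArg (fun f => f x y) this

theorem lift_ofTree_mem_der (h𝔄 : 𝔄.IsDAlgebra) (hν : ∀ c, ν c ∈ 𝔄.Der) (t : PTree C) :
    𝔄.lift ν (ofTree t) ∈ 𝔄.Der := by
  obtain ⟨c, u⟩ := t
  rw [lift_ofTree h𝔄, evalTree]
  exact h𝔄.br_mem_der _ (hν c) _

theorem br_one (h𝔄 : 𝔄.IsDAlgebra) {f : A} (hf : f ∈ 𝔄.Der) : 𝔄.br f 𝔄.one = 0 := by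
  have h := hf 𝔄.one 𝔄.one
  rw [h𝔄.one_mul, h𝔄.mul_one, h𝔄.one_mul] at h
  exact left_eq_add.1 h

variable {gr : NA C →ₗ[ℝ] NA C →ₗ[ℝ] NA C}

theorem lift_gr_leaf (hg : IsGrafting gr) (h𝔄 : 𝔄.IsDAlgebra) (x : NA C) (c : C) :
    𝔄.lift ν (gr x (ofTree (PTree.node c PForest.nil))) = 𝔄.br (𝔄.lift ν x) (ν c) := by
  have : 𝔄.lift ν ∘ₗ gr.flip (ofTree (PTree.node c PForest.nil)) =
      𝔄.br.flip (ν c) ∘ₗ 𝔄.lift ν := by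
    refine hom_ext fun u => ?_
    simp only [LinearMap.comp_apply, LinearMap.flip_apply]
    rw [hg.leaf, lift_ofTree h𝔄, evalTree, lift_of]
  exact congrArg (fun f => f x) this

theorem lift_gr_ofTree (hg : IsGrafting gr) (h𝔄 : 𝔄.IsDAlgebra) (hν : ∀ c, ν c ∈ 𝔄.Der)
    (τ : PTree C) (x : NA C) :
    𝔄.lift ν (gr (ofTree τ) x) = 𝔄.br (𝔄.lift ν (ofTree τ)) (𝔄.lift ν x) := by
  have hτ := lift_ofTree_mem_der h𝔄 hν τ
  have : 𝔄.lift ν ∘ₗ gr (ofTree τ) = 𝔄.br (𝔄.lift ν (ofTree τ)) ∘ₗ 𝔄.lift ν := by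
    refine hom_ext fun u => ?_
    simp only [LinearMap.comp_apply]
    induction u using PForest.forest_induction with
    | nil => rw [hg.gr_one, map_zero, lift_one, br_one h𝔄 hτ]
    | cons c u v hu hv =>
      have hc : 𝔄.lift ν (gr (ofTree τ) (ofTree (PTree.node c u))) =
          𝔄.br (𝔄.lift ν (ofTree τ)) (𝔄.lift ν (ofTree (PTree.node c u))) := by
        rw [hg.gr_node, map_add, lift_gr_leaf hg h𝔄, hu, ← hg.leaf, lift_gr_leaf hg h𝔄, ← hg.leaf,
          lift_gr_leaf hg h𝔄, h𝔄.br_comp _ hτ, ← lift_mul h𝔄, concL_of, PForest.app, PForest.app]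
      have hcons : of (PForest.cons (PTree.node c u) v) =
          concL (ofTree (PTree.node c u)) (of v) := by
        rw [concL_of, PForest.app, PForest.app]
      rw [hg.gr_cons, map_add, lift_mul h𝔄, lift_mul h𝔄, hc, hv, hcons, lift_mul h𝔄, hτ]
  exact congrArg (fun f => f x) this

theorem lift_cons (h𝔄 : 𝔄.IsDAlgebra) (τ : PTree C) (ω : PForest C) :
    𝔄.lift ν (of (PForest.cons τ ω)) = 𝔄.mul (𝔄.lift ν (ofTree τ)) (𝔄.lift ν (of ω)) := by
  rw [← lift_mul h𝔄, concL_of, PForest.app, PForest.app]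

theorem lift_gr (hg : IsGrafting gr) (h𝔄 : 𝔄.IsDAlgebra) (hν : ∀ c, ν c ∈ 𝔄.Der) (x y : NA C) :
    𝔄.lift ν (gr x y) = 𝔄.br (𝔄.lift ν x) (𝔄.lift ν y) := by
  have : LinearMap.eqLocus (gr.compr₂ (𝔄.lift ν)) (𝔄.br.compl₁₂ (𝔄.lift ν) (𝔄.lift ν)) = ⊤ := by
    refine hg.eq_top_of_cons _ ?_ fun τ ω h h' => ?_
    · rw [LinearMap.mem_eqLocus]
      ext1 w
      ext
      simp [hg.one_gr, lift_one, h𝔄.one_br]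
    · rw [LinearMap.mem_eqLocus] at h h' ⊢
      refine LinearMap.ext fun y => ?_
      have h := congrArg (fun f => f y) h
      have h' := congrArg (fun f => f y) h'
      simp only [LinearMap.compr₂_apply, LinearMap.compl₁₂_apply] at h h' ⊢
      rw [← add_sub_cancel_right (gr (of (PForest.cons τ ω)) y) (gr (gr (ofTree τ) (of ω)) y),
        ← hg.gr_gr, map_sub, h', lift_gr_ofTree hg h𝔄 hν, lift_gr_ofTree hg h𝔄 hν, h,
        h𝔄.br_comp _ (lift_ofTree_mem_der h𝔄 hν τ), add_sub_cancel_right, lift_cons h𝔄 τ ω]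
  have hx : x ∈ LinearMap.eqLocus (gr.compr₂ (𝔄.lift ν)) (𝔄.br.compl₁₂ (𝔄.lift ν) (𝔄.lift ν)) :=
    this ▸ Submodule.mem_top
  exact congrArg (fun f => f y) hx

/-- Sends the forest of two trees with branches `u` and `v` to `u[g]v[h]`, where `u`, `v` act
through the universal map, and every other forest to `0`. -/
def pairing (𝔄 : DAlgData A) (ν : C → A) (g h : A) : NA C →ₗ[ℝ] A :=
  Finsupp.linearCombination ℝ fun w : PForest C =>
    match w with
    | .cons (.node _ u) (.cons (.node _ v) .nil) =>
      𝔄.mul (𝔄.br (𝔄.evalForest ν u) g) (𝔄.br (𝔄.evalForest ν v) h)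
    | _ => 0

theorem pairing_concL (hg : IsGrafting gr) (g h : A) (c : C) (x y : NA C) :
    𝔄.pairing ν g h (concL (gr x (ofTree (PTree.node c PForest.nil)))
      (gr y (ofTree (PTree.node c PForest.nil)))) =
      𝔄.mul (𝔄.br (𝔄.lift ν x) g) (𝔄.br (𝔄.lift ν y) h) := by
  have : (concL.compl₁₂ (gr.flip (ofTree (PTree.node c PForest.nil)))
      (gr.flip (ofTree (PTree.node c PForest.nil)))).compr₂ (𝔄.pairing ν g h) =
      𝔄.mul.compl₁₂ (𝔄.br.flip g ∘ₗ 𝔄.lift ν) (𝔄.br.flip h ∘ₗ 𝔄.lift ν) := by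
    refine hom_ext fun u => hom_ext fun v => ?_
    simp only [LinearMap.compr₂_apply, LinearMap.compl₁₂_apply, LinearMap.flip_apply,
      LinearMap.comp_apply, hg.leaf, concL_of, PForest.app, lift_of]
    simp [pairing]
  exact congrArg (fun f => f x y) this

theorem pairing_gr (hg : IsGrafting gr) (h𝔄 : 𝔄.IsDAlgebra) (hν : ∀ c, ν c ∈ 𝔄.Der) (g h : A)
    (c : C) (τ : PTree C) {z : NA C} (hz : z ∈ IsGrafting.twoRooted gr c) :
    𝔄.pairing ν g h (gr (ofTree τ) z) =
      𝔄.br (𝔄.lift ν (ofTree τ)) (𝔄.pairing ν g h z) := by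
  have hτ := lift_ofTree_mem_der h𝔄 hν τ
  induction hz using Submodule.span_induction with
  | zero => simp
  | add a b _ _ ha hb => simp only [map_add, ha, hb]
  | smul r a _ ha => simp only [map_smul, ha]
  | mem z hz =>
    obtain ⟨x, y, rfl⟩ := hz
    rw [hg.gr_concL, hg.gr_ofTree_gr, hg.gr_ofTree_gr, map_add, pairing_concL hg,
      pairing_concL hg, pairing_concL hg, hτ, h𝔄.br_comp _ hτ, h𝔄.br_comp _ hτ]
    simp only [map_add, LinearMap.add_apply, lift_mul h𝔄, lift_gr_ofTree hg h𝔄 hν]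

/-- The action of `N` on a product is determined by its action on the forest of two leaves. -/
theorem br_lift_mul (hg : IsGrafting gr) (h𝔄 : 𝔄.IsDAlgebra) (hν : ∀ c, ν c ∈ 𝔄.Der) (c : C)
    (x : NA C) (g h : A) :
    𝔄.br (𝔄.lift ν x) (𝔄.mul g h) = 𝔄.pairing ν g h (gr x
      (concL (ofTree (PTree.node c PForest.nil)) (ofTree (PTree.node c PForest.nil)))) := by
  set z : NA C := concL (ofTree (PTree.node c PForest.nil)) (ofTree (PTree.node c PForest.nil))
    with hz
  have hz1 : z = concL (gr (of PForest.nil) (ofTree (PTree.node c PForest.nil)))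
      (gr (of PForest.nil) (ofTree (PTree.node c PForest.nil))) := by
    rw [hg.one_gr]
  have htop : (IsGrafting.twoRooted gr c).comap (gr.flip z) ⊓ LinearMap.eqLocus
      (𝔄.br.flip (𝔄.mul g h) ∘ₗ 𝔄.lift ν) (𝔄.pairing ν g h ∘ₗ gr.flip z) = ⊤ := by
    refine hg.eq_top_of_cons _ ⟨?_, ?_⟩ fun τ ω => ?_
    · rw [SetLike.mem_coe, Submodule.mem_comap, LinearMap.flip_apply, hg.one_gr, hz1]
      exact Submodule.subset_span ⟨_, _, rfl⟩
    · simp only [SetLike.mem_coe, LinearMap.mem_eqLocus, LinearMap.comp_apply,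
        LinearMap.flip_apply]
      rw [hg.one_gr, hz1, pairing_concL hg, lift_one, h𝔄.one_br, h𝔄.one_br, h𝔄.one_br]
    · simp only [Submodule.mem_inf, Submodule.mem_comap, LinearMap.mem_eqLocus,
        LinearMap.comp_apply, LinearMap.flip_apply]
      rintro ⟨hω, hωz⟩ ⟨hτω, hτωz⟩
      rw [eq_sub_of_add_eq (hg.gr_gr τ ω z).symm]
      refine ⟨sub_mem (hg.gr_mem_twoRooted c τ hω) hτω, ?_⟩
      rw [map_sub, pairing_gr hg h𝔄 hν g h c τ hω, ← hωz, ← hτωz, lift_gr_ofTree hg h𝔄 hν,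
        h𝔄.br_comp _ (lift_ofTree_mem_der h𝔄 hν τ), add_sub_cancel_right, lift_cons h𝔄 τ ω]
  have hx : x ∈ (IsGrafting.twoRooted gr c).comap (gr.flip z) ⊓ LinearMap.eqLocus
      (𝔄.br.flip (𝔄.mul g h) ∘ₗ 𝔄.lift ν) (𝔄.pairing ν g h ∘ₗ gr.flip z) :=
    htop ▸ Submodule.mem_top
  exact hx.2

theorem lift_mem_der (hg : IsGrafting gr) (h𝔄 : 𝔄.IsDAlgebra) (hν : ∀ c, ν c ∈ 𝔄.Der)
    {x : NA C} (hx : x ∈ DAlgData.Der ⟨concL, of PForest.nil, gr⟩) : 𝔄.lift ν x ∈ 𝔄.Der := by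
  rcases isEmpty_or_nonempty C with hC | ⟨⟨c⟩⟩
  · rw [hg.eq_zero_of_mem_der hx]
    intro g h
    simp
  · intro g h
    have hxc : gr x (concL (ofTree (PTree.node c PForest.nil))
        (ofTree (PTree.node c PForest.nil))) = _ :=
      hx (ofTree (PTree.node c PForest.nil)) _
    have hl := pairing_concL (𝔄 := 𝔄) (ν := ν) hg g h c x (of PForest.nil)
    have hr := pairing_concL (𝔄 := 𝔄) (ν := ν) hg g h c (of PForest.nil) x
    rw [hg.one_gr, lift_one, h𝔄.one_br] at hl hr
    rw [br_lift_mul hg h𝔄 hν c, hxc, map_add, hl, hr]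

theorem lift_isDAlgHom (hg : IsGrafting gr) (h𝔄 : 𝔄.IsDAlgebra) (hν : ∀ c, ν c ∈ 𝔄.Der) :
    IsDAlgHom ⟨concL, of PForest.nil, gr⟩ 𝔄 (𝔄.lift ν) :=
  ⟨lift_one, lift_mul h𝔄, lift_gr hg h𝔄 hν, fun _ hx => lift_mem_der hg h𝔄 hν hx⟩

theorem eq_lift (hg : IsGrafting gr) {F : NA C →ₗ[ℝ] A}
    (hF : IsDAlgHom ⟨concL, of PForest.nil, gr⟩ 𝔄 F)
    (hFν : ∀ c, F (ofTree (PTree.node c PForest.nil)) = ν c) : F = 𝔄.lift ν := by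
  obtain ⟨hone, hmul, hbr, -⟩ := hF
  refine hom_ext fun w => ?_
  rw [lift_of]
  induction w using PForest.forest_induction with
  | nil => rw [evalForest]; exact hone
  | cons c u v hu hv =>
    have h : of (PForest.cons (PTree.node c u) v) =
        concL (gr (of u) (ofTree (PTree.node c PForest.nil))) (of v) := by
      rw [hg.leaf, concL_of, PForest.app, PForest.app]
    rw [h, evalForest, evalTree, ← hu, ← hv, ← hFν c, ← hbr, ← hmul]

end DAlgData

/-- `N = ℝ⟨OT⟩` with concatenation, left grafting and unit the empty
forest is the free D-algebra over the set of colors `C`: for any D-algebra `A` and any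
map `ν : C → D(A)` there is a unique D-algebra homomorphism `F_ν : N → A` with
`F_ν(c) = ν(c)` for all one-node trees `c ∈ C`. -/
theorem N_is_free_D_algebra
    (C : Type)
    (gr : NA C →ₗ[ℝ] NA C →ₗ[ℝ] NA C)
    (h1 : ∀ (ω : PForest C) (c : C),
      gr (Finsupp.single ω 1) (Finsupp.single (bplusF c PForest.nil) 1) =
        Finsupp.single (bplusF c ω) 1)
    (h2 : ∀ ω : PForest C,
      gr (Finsupp.single PForest.nil 1) (Finsupp.single ω 1) = Finsupp.single ω 1)
    (h3 : ∀ (τ : PTree C) (ω ω' : PForest C),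
      gr (Finsupp.single (PForest.cons τ PForest.nil) 1)
          (Finsupp.single (ω.app ω') 1) =
        concL (gr (Finsupp.single (PForest.cons τ PForest.nil) 1)
            (Finsupp.single ω 1)) (Finsupp.single ω' 1)
          + concL (Finsupp.single ω 1)
              (gr (Finsupp.single (PForest.cons τ PForest.nil) 1)
                (Finsupp.single ω' 1)))
    (h4 : ∀ (τ : PTree C) (ω ω' : PForest C),
      gr (Finsupp.single (PForest.cons τ ω) 1) (Finsupp.single ω' 1) =
        gr (Finsupp.single (PForest.cons τ PForest.nil) 1)
            (gr (Finsupp.single ω 1) (Finsupp.single ω' 1))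
          - gr (gr (Finsupp.single (PForest.cons τ PForest.nil) 1)
              (Finsupp.single ω 1)) (Finsupp.single ω' 1)) :
    ∀ (A : Type) [AddCommGroup A] [Module ℝ A] (𝔄 : DAlgData A),
      𝔄.IsDAlgebra →
      ∀ ν : C → A, (∀ c : C, ν c ∈ 𝔄.Der) →
        ∃! F : NA C →ₗ[ℝ] A,
          IsDAlgHom ⟨concL, Finsupp.single PForest.nil 1, gr⟩ 𝔄 F ∧
          ∀ c : C, F (Finsupp.single (bplusF c PForest.nil) 1) = ν c := by

  have hg : IsGrafting gr := ⟨h1, h2, h3, h4⟩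
  intro A _ _ 𝔄 h𝔄 ν hν
  exact ⟨𝔄.lift ν, ⟨DAlgData.lift_isDAlgHom hg h𝔄 hν, DAlgData.lift_leaf h𝔄⟩,
    fun F hF => DAlgData.eq_lift hg hF.1 hF.2⟩

end
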